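/- For every real number λ > 0, the sequence M^λ defined by M^λ_j = exp(λ j²/4) is a weight sequence that satisfies the strong non-quasianalyticity condition but does not have moderate growth; that is, there exists A > 0 with Σ_{j≥k} M^λ_j/((j+1) M^λ_{j+1}) ≤ A M^λ_k/M^λ_{k+1} for all k ∈ ℕ, while there is no constant A > 0 with M^λ_{j+k} ≤ A^{j+k} M^λ_j M^λ_k for all j,k ∈ ℕ. -/

import Mathlib

open Set Filter MeasureTheory Topology

/-- A weight sequence: positive, nondecreasing, `M 0 = 1`, logarithmically convex
(the sequence of ratios `M (j+1) / M j` is nondecreasing), and `M j ^ (1/j) → ∞`. -/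
def IsWeightSeq (M : ℕ → ℝ) : Prop :=
  (∀ j, 0 < M j) ∧ Monotone M ∧ M 0 = 1 ∧
  (∀ j, M (j + 1) / M j ≤ M (j + 2) / M (j + 1)) ∧
  Tendsto (fun j : ℕ => (M j) ^ (1 / (j : ℝ))) atTop atTop

/-- The moderate growth condition. -/
def ModerateGrowth (M : ℕ → ℝ) : Prop :=
  ∃ A > 0, ∀ j k : ℕ, M (j + k) ≤ A ^ (j + k) * (M j * M k)

/-- The strong non-quasianalyticity condition. -/
def StrongNQA (M : ℕ → ℝ) : Prop :=
  ∃ A > 0, ∀ k : ℕ, ∑' j : ℕ, M (k + j) / (((k + j : ℕ) + 1) * M ((k + j) + 1))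
      ≤ A * (M k / M (k + 1))

/-- The sequence `M^λ_j = exp(λ j²/4)` is a weight sequence satisfying strong
non-quasianalyticity but not moderate growth. -/
theorem expSq_weight_seq (lam : ℝ) (hlam : 0 < lam) :
    IsWeightSeq (fun j : ℕ => Real.exp (lam * (j : ℝ) ^ 2 / 4)) ∧
    StrongNQA (fun j : ℕ => Real.exp (lam * (j : ℝ) ^ 2 / 4)) ∧
    ¬ ModerateGrowth (fun j : ℕ => Real.exp (lam * (j : ℝ) ^ 2 / 4)) := by
  refine ⟨⟨fun j => Real.exp_pos _, ?_, by simp, ?_, ?_⟩, ?_, ?_⟩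
  · intro i j hij
    dsimp only
    gcongr
  · intro j
    dsimp only
    rw [← Real.exp_sub, ← Real.exp_sub, Real.exp_le_exp]
    push_cast
    nlinarith
  · have h : Tendsto (fun j : ℕ => Real.exp (lam / 4 * (j : ℝ))) atTop atTop :=
      Real.tendsto_exp_atTop.comp
        (tendsto_natCast_atTop_atTop.const_mul_atTop (by positivity))
    refine h.congr' ?_
    filter_upwards [eventually_gt_atTop 0] with j hj
    have hj' : (j : ℝ) ≠ 0 := by positivity
    rw [← Real.exp_mul]
    congr 1
    field_simp
  · have hr : Real.exp (-lam / 2) < 1 := by rw [Real.exp_lt_one_iff]; linarith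
    refine ⟨(1 - Real.exp (-lam / 2))⁻¹, inv_pos.2 (sub_pos.2 hr), fun k => ?_⟩
    have hgeom := (hasSum_geometric_of_lt_one (Real.exp_pos (-lam / 2)).le hr).mul_right
      (Real.exp (lam * (k : ℝ) ^ 2 / 4) / Real.exp (lam * ((k + 1 : ℕ) : ℝ) ^ 2 / 4))
    have hle (j : ℕ) : Real.exp (lam * ((k + j : ℕ) : ℝ) ^ 2 / 4) /
        (((k + j : ℕ) + 1) * Real.exp (lam * ((k + j + 1 : ℕ) : ℝ) ^ 2 / 4)) ≤
        Real.exp (-lam / 2) ^ j *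
          (Real.exp (lam * (k : ℝ) ^ 2 / 4) / Real.exp (lam * ((k + 1 : ℕ) : ℝ) ^ 2 / 4)) := by
      calc
        _ ≤ Real.exp (lam * ((k + j : ℕ) : ℝ) ^ 2 / 4) /
            Real.exp (lam * ((k + j + 1 : ℕ) : ℝ) ^ 2 / 4) := by
          gcongr
          exact le_mul_of_one_le_left (Real.exp_pos _).le (by simp; positivity)
        _ = _ := by
          rw [← Real.exp_sub, ← Real.exp_sub, ← Real.exp_nat_mul, ← Real.exp_add]
          congr 1
          push_cast
          ring
    rw [← hgeom.tsum_eq]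
    exact (hgeom.summable.of_nonneg_of_le (fun j => by positivity) hle).tsum_le_tsum hle
      hgeom.summable
  · rintro ⟨A, hA, h⟩
    obtain ⟨n, hn⟩ := exists_nat_gt (max 0 (4 * Real.log A / lam))
    have hn0 : (0 : ℝ) < n := (le_max_left _ _).trans_lt hn
    have hn1 : 4 * Real.log A < n * lam := (div_lt_iff₀ hlam).1 ((le_max_right _ _).trans_lt hn)
    have h2 := Real.log_le_log (Real.exp_pos _) (h n n)
    rw [Real.log_exp, Real.log_mul (by positivity) (by positivity), Real.log_pow,
      ← Real.exp_add, Real.log_exp] at h2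
    push_cast at h2
    nlinarith [mul_lt_mul_of_pos_left hn1 hn0]
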